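/- Let M be any trellis automaton over Σ = {a, b} whose state set contains the eleven states {?, 0, 1, 0↗, 1↗, 0↖, 1↖, 0⁰, 0¹, 1⁰, 1¹}, whose initial function satisfies I(a) = 0↗ and I(b) = 0↖, whose accepting-state set is F = {1}, and whose transition function agrees with the 50 listed transitions. Then for every sequential NOR circuit with n ≥ 2 gates, with gate values x₁, …, xₙ and description w bⁿ, M accepts the string w bⁿ (that is, Δ(w bⁿ) ∈ F) if and only if xₙ = 1. -/

import Mathlib

/-- The two-letter alphabet Σ = {a, b}. -/
inductive Letter : Type
  | a
  | b
deriving DecidableEq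

/-- The eleven states: `q` is the question mark `?`; `v0`, `v1` are the plain
states 0, 1; `r0`, `r1` are 0↗, 1↗; `l0`, `l1` are 0↖, 1↖; and `m00`, `m01`,
`m10`, `m11` are the memory states 0⁰, 0¹, 1⁰, 1¹ (value component first). -/
inductive St : Type
  | q
  | v0 | v1
  | r0 | r1
  | l0 | l1
  | m00 | m01 | m10 | m11
deriving DecidableEq

/-- The plain state with value component `x`. -/
def St.plain : Bool → St
  | false => .v0
  | true  => .v1

/-- The state x↗ with value component `x`. -/
def St.up : Bool → St
  | false => .r0
  | true  => .r1

/-- The state x↖ with value component `x`. -/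
def St.dn : Bool → St
  | false => .l0
  | true  => .l1

/-- The memory state x^y with value component `x` and memory component `y`. -/
def St.mem : Bool → Bool → St
  | false, false => .m00
  | false, true  => .m01
  | true,  false => .m10
  | true,  true  => .m11

/-- The 50 listed transitions, as a partial function: `delta50 s t = some r`
means the transition (s, t) ↦ r is listed; `none` means δ may be arbitrary. -/
def delta50 : St → St → Option St
  | .q,   .q   => some .q
  | .v0,  .q   => some .q
  | .v0,  .v0  => some .v0
  | .v0,  .v1  => some .v1
  | .v0,  .r0  => some .v0
  | .v0,  .r1  => some .v1
  | .v0,  .l0  => some .m00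
  | .v0,  .l1  => some .m11
  | .v0,  .m00 => some .v0
  | .v0,  .m01 => some .v0
  | .v0,  .m10 => some .v1
  | .v0,  .m11 => some .v1
  | .v1,  .q   => some .q
  | .v1,  .v0  => some .v0
  | .v1,  .r0  => some .v0
  | .v1,  .l0  => some .m00
  | .v1,  .m00 => some .v0
  | .v1,  .m01 => some .v0
  | .r0,  .q   => some .l1
  | .r0,  .v0  => some .l0
  | .r0,  .v1  => some .l1
  | .r0,  .r0  => some .r0
  | .r0,  .r1  => some .r1
  | .r0,  .l0  => some .r0
  | .r0,  .l1  => some .r1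
  | .r0,  .m11 => some .l1
  | .r1,  .v0  => some .l0
  | .r1,  .r0  => some .r0
  | .r1,  .l0  => some .r0
  | .l0,  .q   => some .q
  | .l0,  .v0  => some .v0
  | .l0,  .v1  => some .v1
  | .l0,  .r0  => some .l0
  | .l0,  .r1  => some .v1
  | .l0,  .l0  => some .q
  | .l0,  .l1  => some .m11
  | .l1,  .q   => some .q
  | .l1,  .v0  => some .v0
  | .l1,  .m00 => some .v0
  | .l1,  .m01 => some .v0
  | .m00, .q   => some .v1
  | .m00, .v0  => some .m00
  | .m00, .v1  => some .m10
  | .m01, .q   => some .v0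
  | .m01, .v0  => some .m01
  | .m01, .v1  => some .m11
  | .m10, .q   => some .v0
  | .m10, .v0  => some .m00
  | .m11, .q   => some .v0
  | .m11, .v0  => some .m01
  | _,    _    => none

/-- The result function Δ of a trellis automaton with initial function `I` and
transition function `d`, defined on nonempty strings by Δ(c) = I(c) and
Δ(c w d) = δ(Δ(c w), Δ(w d)); the value on the empty string is junk. -/
def Delta {Q : Type*} (I : Letter → Q) (d : Q → Q → Q) : List Letter → Q
  | [] => I Letter.a
  | [c] => I c
  | c :: x :: xs => d (Delta I d (c :: (x :: xs).dropLast)) (Delta I d (x :: xs))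
termination_by l => l.length
decreasing_by
  · simp [List.length_dropLast]
  · simp

/-- The description `w` (without the work-space suffix bⁿ) of the sequential
NOR circuit with `n` gates and indices `j`:
`w = b a^{jₙ} b a^{jₙ₋₁} ⋯ b a^{j₃} b a b`. -/
def descW (j : ℕ → ℕ) : ℕ → List Letter
  | 0 => []
  | 1 => []
  | 2 => [Letter.b, Letter.a, Letter.b]
  | (m+3) => (Letter.b :: List.replicate (j (m+3)) Letter.a) ++ descW j (m+2)

/-- The results of `w_i bᵏ`, where `w_i` describes the first `i` gates and the last of them
reads gate `p`: the value of gate `k`, together with the remembered value of gate `p`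
while `p ≤ k < i`. -/
def gateRow (x : ℕ → Bool) (p i k : ℕ) : St :=
  if k = 0 then .l0 else if k < p then .plain (x k) else if k < i then .mem (x k) (x p)
  else if k = i then .plain (x k) else .q

/-- The results of `aᵗ w_i bᵏ`, where `w_i` describes the first `i` gates: the value of gate `k`,
marked according to the order of `k` and `t`. -/
def shiftRow (x : ℕ → Bool) (i t k : ℕ) : St :=
  if k = 0 then .r0 else if k < t then .up (x k) else if k = t then .dn (x k)
  else if k ≤ i then .plain (x k) else .q

section Values

variable {u v w : Bool}

theorem delta50_up_up (h : u = false ∨ v = false) :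
    delta50 (.up u) (.up v) = some (.up v) := by
  revert h
  cases u <;> cases v <;> decide

theorem delta50_up_dn (h : u = false ∨ v = false) :
    delta50 (.up u) (.dn v) = some (.up v) := by
  revert h
  cases u <;> cases v <;> decide

theorem delta50_up_plain (h : u = false ∨ v = false) :
    delta50 (.up u) (.plain v) = some (.dn v) := by
  revert h
  cases u <;> cases v <;> decide

theorem delta50_dn_plain (h : u = false ∨ v = false) :
    delta50 (.dn u) (.plain v) = some (.plain v) := by
  revert h
  cases u <;> cases v <;> decide

theorem delta50_plain_plain (h : u = false ∨ v = false) :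
    delta50 (.plain u) (.plain v) = some (.plain v) := by
  revert h
  cases u <;> cases v <;> decide

theorem delta50_plain_up (h : u = false ∨ v = false) :
    delta50 (.plain u) (.up v) = some (.plain v) := by
  revert h
  cases u <;> cases v <;> decide

theorem delta50_plain_dn (h : u = false ∨ v = false) :
    delta50 (.plain u) (.dn v) = some (.mem v v) := by
  revert h
  cases u <;> cases v <;> decide

theorem delta50_mem_plain (h : u = false ∨ v = false) :
    delta50 (.mem u w) (.plain v) = some (.mem v w) := by
  revert h
  cases w <;> cases u <;> cases v <;> decide

theorem delta50_plain_mem (h : u = false ∨ v = false) :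
    delta50 (.plain u) (.mem v w) = some (.plain v) := by
  revert h
  cases w <;> cases u <;> cases v <;> decide

theorem delta50_dn_mem (h : v = false) : delta50 (.dn true) (.mem v w) = some (.plain v) := by
  subst h
  cases w <;> rfl

theorem delta50_dn_q : delta50 (.dn u) .q = some .q := by
  cases u <;> rfl

theorem delta50_plain_q : delta50 (.plain u) .q = some .q := by
  cases u <;> rfl

theorem delta50_mem_q : delta50 (.mem u w) .q = some (.plain !(u || w)) := by
  cases u <;> cases w <;> rfl

end Values

section Rows

variable {x : ℕ → Bool} {i p t : ℕ}

theorem delta50_shiftRow_gateRow (hx1 : x 1 = true)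
    (hc : ∀ k, 1 ≤ k → k < i → x k = false ∨ x (k + 1) = false)
    (hp : 1 ≤ p) (hpi : p < i) (k : ℕ) :
    delta50 (shiftRow x i 1 k) (gateRow x p i (k + 1)) = some (shiftRow x i 1 (k + 1)) := by
  unfold shiftRow gateRow
  split_ifs <;> first
    | contradiction
    | omega
    | rfl
    | exact delta50_dn_q
    | exact delta50_plain_q
    | exact delta50_dn_plain (hc k (by omega) (by omega))
    | exact delta50_plain_plain (hc k (by omega) (by omega))
    | exact delta50_plain_mem (hc k (by omega) (by omega))
    | (obtain rfl : k = 0 := by omega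
       simp only [Nat.zero_add, hx1]
       first
       | rfl
       | (obtain rfl : p = 1 := by omega
          rw [hx1]
          rfl))
    | (obtain rfl : k = 1 := by omega
       rw [hx1]
       exact delta50_dn_mem ((hc 1 le_rfl (by omega)).resolve_left (by simp [hx1])))

theorem delta50_shiftRow_shiftRow
    (hc : ∀ k, 1 ≤ k → k < i → x k = false ∨ x (k + 1) = false)
    (ht : 1 ≤ t) (hti : t < i) (k : ℕ) :
    delta50 (shiftRow x i (t + 1) k) (shiftRow x i t (k + 1)) =
      some (shiftRow x i (t + 1) (k + 1)) := by
  unfold shiftRow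
  split_ifs <;> first
    | contradiction
    | omega
    | rfl
    | exact delta50_dn_q
    | exact delta50_plain_q
    | exact delta50_up_up (hc k (by omega) (by omega))
    | exact delta50_up_dn (hc k (by omega) (by omega))
    | exact delta50_up_plain (hc k (by omega) (by omega))
    | exact delta50_dn_plain (hc k (by omega) (by omega))
    | exact delta50_plain_plain (hc k (by omega) (by omega))
    | exact delta50_up_up (u := false) (Or.inl rfl)
    | exact delta50_up_dn (u := false) (Or.inl rfl)

theorem delta50_gateRow_shiftRow (hx1 : x 1 = true)
    (hc : ∀ k, 1 ≤ k → k < i → x k = false ∨ x (k + 1) = false)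
    (hx : x (i + 1) = !(x i || x p)) (hp : 1 ≤ p) (hpi : p ≤ i) (k : ℕ) :
    delta50 (gateRow x p (i + 1) k) (shiftRow x i p (k + 1)) =
      some (gateRow x p (i + 1) (k + 1)) := by
  unfold shiftRow gateRow
  split_ifs <;> first
    | contradiction
    | omega
    | rfl
    | exact delta50_plain_q
    | exact delta50_plain_up (hc k (by omega) (by omega))
    | exact delta50_mem_plain (hc k (by omega) (by omega))
    | (obtain rfl : k = i := by omega
       rw [hx]
       exact delta50_mem_q)
    | (obtain rfl : k = 0 := by omega
       simp only [Nat.zero_add, hx1]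
       rfl)
    | (obtain rfl : p = k + 1 := by omega
       first
       | exact delta50_plain_dn (hc k (by omega) (by omega))
       | (obtain rfl : k = 0 := by omega
          simp only [Nat.zero_add, hx1]
          rfl))

end Rows

section Automaton

variable {Q : Type*} {I : Letter → Q} {δ : Q → Q → Q} {e : St → Q}

theorem Delta_cons_append_replicate (c d : Letter) (s : List Letter) (k : ℕ) :
    Delta I δ (c :: s ++ List.replicate (k + 1) d) =
      δ (Delta I δ (c :: s ++ List.replicate k d))
        (Delta I δ (s ++ List.replicate (k + 1) d)) := by
  have h : ∀ l : List Letter, l ≠ [] →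
      Delta I δ (c :: l) = δ (Delta I δ (c :: l.dropLast)) (Delta I δ l) := by
    intro l hl
    obtain ⟨y, ys, rfl⟩ := List.exists_cons_of_ne_nil hl
    rw [Delta]
  rw [List.cons_append, h _ (by simp)]
  simp [List.replicate_succ', ← List.append_assoc]

theorem Delta_row (hδ : ∀ s t r : St, delta50 s t = some r → δ (e s) (e t) = e r)
    {c : Letter} {s : List Letter} {ρ σ : ℕ → St} (h0 : Delta I δ (c :: s) = e (ρ 0))
    (hs : ∀ k, Delta I δ (s ++ List.replicate (k + 1) Letter.b) = e (σ (k + 1)))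
    (hstep : ∀ k, delta50 (ρ k) (σ (k + 1)) = some (ρ (k + 1))) (k : ℕ) :
    Delta I δ (c :: s ++ List.replicate k Letter.b) = e (ρ k) := by
  induction k with
  | zero => simpa using h0
  | succ k ih => rw [Delta_cons_append_replicate, ih, hs, hδ _ _ _ (hstep k)]

/-- The initial state of a letter. -/
def Letter.toSt : Letter → St
  | .a => .r0
  | .b => .l0

theorem Delta_of_isChain (hI : ∀ c, I c = e c.toSt)
    (hδ : ∀ s t r : St, delta50 s t = some r → δ (e s) (e t) = e r)
    (c : Letter) (s : List Letter)
    (h : (c :: s).IsChain fun y z => y = .a ∨ z = .a) : Delta I δ (c :: s) = e c.toSt := by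
  induction hn : s.length generalizing c s with
  | zero =>
    obtain rfl := List.length_eq_zero_iff.1 hn
    rw [Delta, hI]
  | succ m ih =>
    obtain ⟨y, ys, rfl⟩ := List.exists_cons_of_length_eq_add_one hn
    have hd := h.dropLast
    rw [List.dropLast_cons_of_ne_nil (by simp)] at hd
    rw [Delta, ih c _ hd (by simpa using hn), ih y ys h.tail (by simpa using hn)]
    refine hδ _ _ _ ?_
    rcases (List.isChain_cons_cons.1 h).1 with rfl | rfl
    · cases y <;> rfl
    · cases c <;> rfl

theorem isChain_descW {j : ℕ → ℕ} (n : ℕ) (hn : 2 ≤ n) (hj : ∀ i, 3 ≤ i → i ≤ n → 1 ≤ j i)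
    (t : ℕ) :
    (List.replicate t Letter.a ++ descW j n).IsChain (fun y z => y = .a ∨ z = .a) := by
  have happ : ∀ (t : ℕ) (l : List Letter), l.IsChain (fun y z => y = .a ∨ z = .a) →
      (List.replicate t Letter.a ++ l).IsChain (fun y z => y = .a ∨ z = .a) := by
    intro t l hl
    induction t with
    | zero => simpa using hl
    | succ t ih =>
      rw [List.replicate_succ, List.cons_append, List.isChain_cons]
      exact ⟨fun _ _ => Or.inl rfl, ih⟩
  refine happ t _ ?_
  induction n, hn using Nat.le_induction with
  | base => simp [descW]
  | succ m hm ih =>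
    obtain ⟨m, rfl⟩ := Nat.exists_eq_add_of_le' hm
    obtain ⟨q, hq⟩ := Nat.exists_eq_add_of_le' (hj (m + 3) (by omega) le_rfl)
    have := happ (q + 1) _ (ih fun i h3 hi => hj i h3 (by omega))
    rw [descW, hq]
    simp only [List.replicate_succ, List.cons_append] at this ⊢
    exact List.isChain_cons_cons.2 ⟨Or.inr rfl, this⟩

theorem Delta_descW (hI : ∀ c, I c = e c.toSt)
    (hδ : ∀ s t r : St, delta50 s t = some r → δ (e s) (e t) = e r)
    (n : ℕ) (hn : 2 ≤ n) (j : ℕ → ℕ) (hj : ∀ i, 3 ≤ i → i ≤ n → 1 ≤ j i ∧ j i < i)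
    (x : ℕ → Bool) (hx1 : x 1 = true) (hx2 : x 2 = false)
    (hx : ∀ i, 3 ≤ i → i ≤ n → x i = !(x (i - 1) || x (j i))) :
    ∃ p, 1 ≤ p ∧ p < n ∧
      ∀ k, Delta I δ (descW j n ++ List.replicate k Letter.b) = e (gateRow x p n k) := by
  have hc : ∀ k, 1 ≤ k → k < n → x k = false ∨ x (k + 1) = false := by
    intro k hk hkn
    obtain rfl | hk := hk.eq_or_lt
    · exact Or.inr hx2
    · have := hx (k + 1) (by omega) hkn
      rw [Nat.add_sub_cancel] at this
      cases h : x k <;> simp_all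
  have h0 : ∀ c s, (c :: s).IsChain (fun y z => y = .a ∨ z = .a) → Delta I δ (c :: s) = e c.toSt :=
    Delta_of_isChain hI hδ
  induction n, hn using Nat.le_induction with
  | base =>
    refine ⟨1, le_rfl, by simp, ?_⟩
    have hb : ∀ k, Delta I δ (List.replicate (k + 2) Letter.b) = e .q := by
      intro k
      have h := Delta_cons_append_replicate (I := I) (δ := δ) Letter.b Letter.b []
      simp only [List.cons_append, List.nil_append, ← List.replicate_succ] at h
      induction k with
      | zero =>
        rw [h, List.replicate_one, h0 _ _ (by simp)]
        exact hδ _ _ _ rfl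
      | succ k ih =>
        rw [h, ih]
        exact hδ _ _ _ rfl
    refine Delta_row hδ (h0 _ _ (by simp)) (σ := fun k => if k = 1 then .l1 else .q) (fun k =>
      Delta_row hδ (ρ := fun k => if k = 0 then .r0 else if k = 1 then .l1 else .q)
        (σ := fun _ => .q) (h0 _ _ (by simp)) hb ?_ (k + 1)) ?_
    · rintro (_ | _ | k) <;> rfl
    · rintro (_ | _ | _ | k) <;> simp [gateRow, hx1, hx2] <;> rfl
  | succ i hi ih =>
    obtain ⟨p, hp1, hpi, hrow⟩ := ih (fun k h3 hk => hj k h3 (by omega))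
      (fun k h3 hk => hx k h3 (by omega)) (fun k h1 hk => hc k h1 (by omega))
    have hc' : ∀ k, 1 ≤ k → k < i → x k = false ∨ x (k + 1) = false :=
      fun k h1 hk => hc k h1 (by omega)
    have hch := isChain_descW i hi fun k h3 hk => (hj k h3 (by omega)).1
    obtain ⟨hj1, hji⟩ := hj (i + 1) (by omega) le_rfl
    have hshift : ∀ t, 1 ≤ t → t ≤ i → ∀ k,
        Delta I δ (List.replicate t Letter.a ++ descW j i ++ List.replicate k Letter.b) =
          e (shiftRow x i t k) := by
      intro t ht
      induction t, ht using Nat.le_induction with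
      | base =>
        exact fun _ => Delta_row hδ (h0 _ _ (hch 1)) (fun k => hrow (k + 1))
          (delta50_shiftRow_gateRow hx1 hc' hp1 hpi)
      | succ t ht iht =>
        exact fun hti => Delta_row hδ (h0 _ _ (hch (t + 1))) (fun k => iht (by omega) (k + 1))
          (delta50_shiftRow_shiftRow hc' ht hti)
    refine ⟨j (i + 1), hj1, hji, ?_⟩
    have hd : descW j (i + 1) = Letter.b :: (List.replicate (j (i + 1)) Letter.a ++ descW j i) := by
      obtain ⟨m, rfl⟩ := Nat.exists_eq_add_of_le' hi
      rfl
    have hch' := isChain_descW (i + 1) (by omega) (fun k h3 hk => (hj k h3 hk).1) 0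
    rw [List.replicate_zero, List.nil_append, hd] at hch'
    rw [hd]
    exact Delta_row hδ (h0 _ _ hch') (fun k => hshift _ hj1 (by omega) (k + 1))
      (delta50_gateRow_shiftRow hx1 hc' (by simpa using hx (i + 1) (by omega) le_rfl) hj1 (by omega))

end Automaton

/-- For any trellis automaton over {a,b} whose state set
contains the eleven states (embedded injectively via `e`), whose initial
function sends a ↦ 0↗ and b ↦ 0↖, whose accepting set is F = {1}, and whose
transition function agrees with the 50 listed transitions: for every
sequential NOR circuit with n ≥ 2 gates, gate values x₁, …, xₙ and
description w bⁿ, the automaton accepts w bⁿ iff xₙ = 1. -/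
theorem statement0 {Q : Type*} (I : Letter → Q) (δ : Q → Q → Q) (F : Set Q)
    (e : St → Q) (he : Function.Injective e)
    (hIa : I Letter.a = e St.r0) (hIb : I Letter.b = e St.l0)
    (hδ : ∀ s t r : St, delta50 s t = some r → δ (e s) (e t) = e r)
    (hF : F = {e St.v1})
    (n : ℕ) (hn : 2 ≤ n) (j : ℕ → ℕ)
    (hj : ∀ i, 3 ≤ i → i ≤ n → 1 ≤ j i ∧ j i < i)
    (x : ℕ → Bool) (hx1 : x 1 = true) (hx2 : x 2 = false)
    (hx : ∀ i, 3 ≤ i → i ≤ n → x i = !(x (i - 1) || x (j i))) :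
    Delta I δ (descW j n ++ List.replicate n Letter.b) ∈ F ↔ x n = true := by
  obtain ⟨p, -, hpn, h⟩ :=
    Delta_descW (fun c => by cases c <;> assumption) hδ n hn j hj x hx1 hx2 hx
  rw [h, hF, Set.mem_singleton_iff, he.eq_iff]
  have hn0 : n ≠ 0 := by omega
  cases hxn : x n <;> simp [gateRow, hn0, hpn.not_gt, hxn, St.plain]
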